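/- Let m > 0 and c > 0. Then there is a constant C (depending only on m, c) such that for every integer j ≥ 1, every choice of sign ±, every r ≥ 0, every t ∈ ℝ with t ≠ 0, and every continuously differentiable function a : (0,∞) → ℂ satisfying: a(z) = 0 unless 2^{j−1} ≤ z ≤ 2^{j+1}; a(z) = 0 whenever z·r ≤ c; |a(z)| ≤ z·(1 + z·r)^{−1/2} and |a′(z)| ≤ (1 + z·r)^{−1/2} for all z > 0; one has | ∫₀^∞ e^{−it√(z²+m²)} e^{±izr} a(z) dz | ≤ C·min( 2^{2j}, 2^{3j/2}·|t|^{−1/2}, 2^{2j}·|t|^{−1} ). -/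

import Mathlib

open MeasureTheory

lemma aux_ibp (α β : ℝ) (hαβ : α ≤ β) (φ p : ℝ → ℝ) (g g' : ℝ → ℂ)
    (hφ : ∀ z ∈ Set.Icc α β, HasDerivAt φ (p z) z) (hp : ContinuousOn p (Set.Icc α β))
    (hg : ∀ z ∈ Set.Icc α β, HasDerivAt g (g' z) z) (hg' : ContinuousOn g' (Set.Icc α β)) :
    ‖∫ z in α..β, Complex.exp (Complex.I * (φ z : ℂ)) * ((p z : ℂ) * g z)‖
      ≤ ‖g α‖ + ‖g β‖ + ∫ z in α..β, ‖g' z‖ := by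
  have hφc : ContinuousOn φ (Set.Icc α β) := fun z hz => (hφ z hz).continuousAt.continuousWithinAt
  have hec : ContinuousOn (fun z => Complex.exp (Complex.I * (φ z : ℂ))) (Set.Icc α β) := by
    fun_prop
  have hpc : ContinuousOn (fun z => (p z : ℂ)) (Set.Icc α β) := by fun_prop
  have hn : ∀ x : ℝ, ‖Complex.exp (Complex.I * (x : ℂ))‖ = 1 := by
    intro x; rw [mul_comm]; exact Complex.norm_exp_ofReal_mul_I x
  have key := intervalIntegral.integral_mul_deriv_eq_deriv_mul (a := α) (b := β)
    (u := g) (v := fun z => -Complex.I * Complex.exp (Complex.I * (φ z : ℂ)))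
    (u' := g') (v' := fun z => Complex.exp (Complex.I * (φ z : ℂ)) * (p z : ℂ))
    (by intro z hz; rw [Set.uIcc_of_le hαβ] at hz; exact hg z hz)
    (by
      intro z hz; rw [Set.uIcc_of_le hαβ] at hz
      have h1 := (hφ z hz).ofReal_comp
      have h2 := ((h1.const_mul Complex.I).cexp).const_mul (-Complex.I)
      convert h2 using 1
      linear_combination (Complex.exp (Complex.I * (φ z : ℂ)) * (p z : ℂ)) * Complex.I_sq)
    (by apply ContinuousOn.intervalIntegrable; rwa [Set.uIcc_of_le hαβ])
    (by apply ContinuousOn.intervalIntegrable; rw [Set.uIcc_of_le hαβ]; exact hec.mul hpc)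
  have e : (∫ z in α..β, Complex.exp (Complex.I * (φ z : ℂ)) * ((p z : ℂ) * g z))
      = ∫ z in α..β, g z * (Complex.exp (Complex.I * (φ z : ℂ)) * (p z : ℂ)) := by
    congr 1; ext z; ring
  rw [e, key]
  have h3 : ‖∫ z in α..β, g' z * (-Complex.I * Complex.exp (Complex.I * (φ z : ℂ)))‖
      ≤ ∫ z in α..β, ‖g' z‖ := by
    refine (intervalIntegral.norm_integral_le_integral_norm hαβ).trans (le_of_eq ?_)
    congr 1; ext z
    simp [hn]
  refine (norm_sub_le _ _).trans ?_
  refine add_le_add ((norm_sub_le _ _).trans (le_of_eq ?_)) h3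
  simp [hn]; ring

lemma aux_vdc (α β : ℝ) (hαβ : α ≤ β) (φ p q : ℝ → ℝ) (a a' : ℝ → ℂ) (M B lam ε : ℝ)
    (hM : 0 ≤ M) (hlam : 0 < lam) (hε : ε = 1 ∨ ε = -1)
    (hφ : ∀ z ∈ Set.Icc α β, HasDerivAt φ (p z) z)
    (hp : ∀ z ∈ Set.Icc α β, HasDerivAt p (q z) z) (hq : ContinuousOn q (Set.Icc α β))
    (ha : ∀ z ∈ Set.Icc α β, HasDerivAt a (a' z) z) (ha' : ContinuousOn a' (Set.Icc α β))
    (hqm : ∀ z ∈ Set.Icc α β, lam ^ 2 ≤ ε * q z)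
    (haM : ∀ z ∈ Set.Icc α β, ‖a z‖ ≤ M) (haB : ∀ z ∈ Set.Icc α β, ‖a' z‖ ≤ B) :
    ‖∫ z in α..β, Complex.exp (Complex.I * (φ z : ℂ)) * a z‖
      ≤ (M + B * (β - α) + 2 * Real.pi * M) / lam := by
  have hn : ∀ x : ℝ, ‖Complex.exp (Complex.I * (x : ℂ))‖ = 1 := by
    intro x; rw [mul_comm]; exact Complex.norm_exp_ofReal_mul_I x
  have hφc : ContinuousOn φ (Set.Icc α β) := fun z hz => (hφ z hz).continuousAt.continuousWithinAt
  have hpc : ContinuousOn p (Set.Icc α β) := fun z hz => (hp z hz).continuousAt.continuousWithinAt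
  have hac : ContinuousOn a (Set.Icc α β) := fun z hz => (ha z hz).continuousAt.continuousWithinAt
  have hD : ∀ z, 0 < lam ^ 2 + p z ^ 2 := fun z => by positivity
  have hDc : ContinuousOn (fun z => lam ^ 2 + p z ^ 2) (Set.Icc α β) := by fun_prop
  have hwc : ContinuousOn (fun z => p z / (lam ^ 2 + p z ^ 2)) (Set.Icc α β) :=
    hpc.div hDc (fun z _ => (hD z).ne')
  have hw'c : ContinuousOn (fun z => q z * (lam ^ 2 - p z ^ 2) / (lam ^ 2 + p z ^ 2) ^ 2)
      (Set.Icc α β) := by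
    refine ContinuousOn.div (by fun_prop) (by fun_prop) (fun z _ => (pow_pos (hD z) 2).ne')
  have hbc : ContinuousOn (fun z => ε * q z / (lam ^ 2 + p z ^ 2)) (Set.Icc α β) :=
    ContinuousOn.div (by fun_prop) hDc (fun z _ => (hD z).ne')
  have hvc : ContinuousOn (fun z => lam ^ 2 / (lam ^ 2 + p z ^ 2)) (Set.Icc α β) :=
    ContinuousOn.div (by fun_prop) hDc (fun z _ => (hD z).ne')
  have hII : ∀ {E : Type} [NormedAddCommGroup E] {f : ℝ → E}, ContinuousOn f (Set.Icc α β) →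
      IntervalIntegrable f volume α β := by
    intro E _ f hf
    apply ContinuousOn.intervalIntegrable; rwa [Set.uIcc_of_le hαβ]
  have hw : ∀ z ∈ Set.Icc α β, HasDerivAt (fun z => p z / (lam ^ 2 + p z ^ 2))
      (q z * (lam ^ 2 - p z ^ 2) / (lam ^ 2 + p z ^ 2) ^ 2) z := by
    intro z hz
    have h := (hp z hz).fun_div (((hp z hz).fun_pow 2).const_add (lam ^ 2)) (hD z).ne'
    refine h.congr_deriv ?_
    congr 1
    push_cast; ring
  -- the integral of the majorant
  have hJ : (∫ z in α..β, ε * q z / (lam ^ 2 + p z ^ 2)) ≤ Real.pi / lam := by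
    have h := intervalIntegral.integral_eq_sub_of_hasDerivAt (a := α) (b := β)
      (f := fun z => ε / lam * Real.arctan (p z / lam))
      (f' := fun z => ε * q z / (lam ^ 2 + p z ^ 2))
      (by
        intro z hz; rw [Set.uIcc_of_le hαβ] at hz
        have h := (((hp z hz).div_const lam).arctan).const_mul (ε / lam)
        refine HasDerivAt.congr_deriv h ?_
        have := (hD z).ne'
        have h2 : (1 + (p z / lam) ^ 2) ≠ 0 := by positivity
        field_simp)
      (hII hbc)
    rw [h]
    have e1 := Real.arctan_lt_pi_div_two (p β / lam)
    have e2 := Real.arctan_lt_pi_div_two (p α / lam)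
    have e3 := Real.neg_pi_div_two_lt_arctan (p β / lam)
    have e4 := Real.neg_pi_div_two_lt_arctan (p α / lam)
    have : ε / lam * Real.arctan (p β / lam) - ε / lam * Real.arctan (p α / lam)
      = (ε * (Real.arctan (p β / lam) - Real.arctan (p α / lam))) / lam := by ring
    simp only [this]
    apply div_le_div_of_nonneg_right _ hlam.le
    rcases hε with h | h <;> subst h <;> linarith
  -- weight bound
  have hwb : ∀ z, |p z / (lam ^ 2 + p z ^ 2)| ≤ 1 / (2 * lam) := by
    intro z
    rw [abs_div, abs_of_pos (hD z), div_le_div_iff₀ (hD z) (by positivity)]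
    nlinarith [sq_nonneg (lam - |p z|), sq_abs (p z)]
  have hB : ∀ z ∈ Set.Icc α β, 0 ≤ B := fun z hz => (norm_nonneg _).trans (haB z hz)
  let g : ℝ → ℂ := fun z => ((p z / (lam ^ 2 + p z ^ 2) : ℝ) : ℂ) * a z
  let g' : ℝ → ℂ := fun z =>
    ((q z * (lam ^ 2 - p z ^ 2) / (lam ^ 2 + p z ^ 2) ^ 2 : ℝ) : ℂ) * a z +
      ((p z / (lam ^ 2 + p z ^ 2) : ℝ) : ℂ) * a' z
  have hg : ∀ z ∈ Set.Icc α β, HasDerivAt g (g' z) z := fun z hz =>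
    (hw z hz).ofReal_comp.mul (ha z hz)
  have hg'c : ContinuousOn g' (Set.Icc α β) :=
    ((Complex.continuous_ofReal.comp_continuousOn hw'c).mul hac).add
      ((Complex.continuous_ofReal.comp_continuousOn hwc).mul ha')
  have h1 := aux_ibp α β hαβ φ p g g' hφ hpc hg hg'c
  have hgb : ∀ z ∈ Set.Icc α β, ‖g z‖ ≤ M / (2 * lam) := by
    intro z hz
    simp only [g, norm_mul, Complex.norm_real, Real.norm_eq_abs]
    calc _ ≤ 1 / (2 * lam) * M := mul_le_mul (hwb z) (haM z hz) (norm_nonneg _) (by positivity)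
      _ = _ := by ring
  have hqa : ∀ z ∈ Set.Icc α β, |q z| = ε * q z := by
    intro z hz
    have := hqm z hz
    have h0 : 0 < ε * q z := lt_of_lt_of_le (by positivity) this
    rcases hε with h | h <;> subst h
    · rw [one_mul] at *; exact abs_of_pos h0
    · rw [abs_of_neg] <;> linarith
  have hg'b : ∀ z ∈ Set.Icc α β, ‖g' z‖ ≤ M * (ε * q z / (lam ^ 2 + p z ^ 2)) + B / (2 * lam) := by
    intro z hz
    refine (norm_add_le _ _).trans (add_le_add ?_ ?_)
    · simp only [norm_mul, Complex.norm_real, Real.norm_eq_abs]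
      rw [mul_comm M]
      refine mul_le_mul ?_ (haM z hz) (norm_nonneg _) ?_
      · rw [abs_div, abs_mul, hqa z hz, abs_of_pos (pow_pos (hD z) 2), div_le_div_iff₀ (pow_pos (hD z) 2) (hD z)]
        have h0 : 0 ≤ ε * q z := le_trans (by positivity) (hqm z hz)
        have h5 : |lam ^ 2 - p z ^ 2| ≤ lam ^ 2 + p z ^ 2 := by
          rw [abs_le]; constructor <;> nlinarith [sq_nonneg lam, sq_nonneg (p z)]
        calc _ ≤ ε * q z * (lam ^ 2 + p z ^ 2) * (lam ^ 2 + p z ^ 2) := by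
              have := hD z
              gcongr
          _ = _ := by ring
      · rw [← hqa z hz]; have := hD z; positivity
    · simp only [norm_mul, Complex.norm_real, Real.norm_eq_abs]
      calc _ ≤ 1 / (2 * lam) * B := mul_le_mul (hwb z) (haB z hz) (norm_nonneg _) (by positivity)
        _ = _ := by ring
  have hMb : IntervalIntegrable (fun z => M * (ε * q z / (lam ^ 2 + p z ^ 2))) volume α β :=
    (hII hbc).const_mul M
  have h2 : (∫ z in α..β, ‖g' z‖) ≤ M * (Real.pi / lam) + B / (2 * lam) * (β - α) := by
    calc _ ≤ ∫ z in α..β, (M * (ε * q z / (lam ^ 2 + p z ^ 2)) + B / (2 * lam)) :=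
          intervalIntegral.integral_mono_on hαβ (hII hg'c.norm)
            (hMb.add (by simp)) hg'b
      _ = M * (∫ z in α..β, ε * q z / (lam ^ 2 + p z ^ 2)) + B / (2 * lam) * (β - α) := by
          rw [intervalIntegral.integral_add hMb (by simp), intervalIntegral.integral_const_mul]
          simp; ring
      _ ≤ _ := by gcongr
  have hec : ContinuousOn (fun z => Complex.exp (Complex.I * (φ z : ℂ))) (Set.Icc α β) := by
    fun_prop
  have h3 : ‖∫ z in α..β, Complex.exp (Complex.I * (φ z : ℂ)) *
      (((lam ^ 2 / (lam ^ 2 + p z ^ 2) : ℝ) : ℂ) * a z)‖ ≤ M * (Real.pi / lam) := by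
    refine (intervalIntegral.norm_integral_le_integral_norm hαβ).trans ?_
    calc _ ≤ ∫ z in α..β, (M * (ε * q z / (lam ^ 2 + p z ^ 2))) := by
          refine intervalIntegral.integral_mono_on hαβ (hII ?_) hMb ?_
          · exact (hec.mul ((Complex.continuous_ofReal.comp_continuousOn hvc).mul hac)).norm
          · intro z hz
            simp only [norm_mul, Complex.norm_real, Real.norm_eq_abs, hn, one_mul]
            rw [mul_comm M]
            have := hD z
            refine mul_le_mul ?_ (haM z hz) (norm_nonneg _) ?_
            · rw [abs_of_pos (by positivity)]
              exact div_le_div_of_nonneg_right (hqm z hz) this.le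
            · rw [← hqa z hz]; positivity
      _ = M * (∫ z in α..β, ε * q z / (lam ^ 2 + p z ^ 2)) := by
          rw [intervalIntegral.integral_const_mul]
      _ ≤ _ := by gcongr
  have hsplit : (∫ z in α..β, Complex.exp (Complex.I * (φ z : ℂ)) * a z)
      = (∫ z in α..β, Complex.exp (Complex.I * (φ z : ℂ)) * ((p z : ℂ) * g z))
        + ∫ z in α..β, Complex.exp (Complex.I * (φ z : ℂ)) *
      (((lam ^ 2 / (lam ^ 2 + p z ^ 2) : ℝ) : ℂ) * a z) := by
    rw [← intervalIntegral.integral_add]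
    · congr 1; ext z
      have : ((p z * (p z / (lam ^ 2 + p z ^ 2)) + lam ^ 2 / (lam ^ 2 + p z ^ 2) : ℝ) : ℂ) = 1 := by
        have := (hD z).ne'
        rw [← Complex.ofReal_one]; congr 1; field_simp; ring
      rw [Complex.ofReal_add, Complex.ofReal_mul] at this
      simp only [g]
      linear_combination (-Complex.exp (Complex.I * (φ z : ℂ)) * a z) * this
    · apply hII
      exact hec.mul ((Complex.continuous_ofReal.comp_continuousOn hpc).mul
        ((Complex.continuous_ofReal.comp_continuousOn hwc).mul hac))
    · apply hII
      exact hec.mul ((Complex.continuous_ofReal.comp_continuousOn hvc).mul hac)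
  rw [hsplit]
  refine (norm_add_le _ _).trans ?_
  have hα := hgb α ⟨le_rfl, hαβ⟩
  have hβ := hgb β ⟨hαβ, le_rfl⟩
  have hB0 := hB α ⟨le_rfl, hαβ⟩
  have hfin : (M + B * (β - α) + 2 * Real.pi * M) / lam = M / (2 * lam) + M / (2 * lam) +
    (M * (Real.pi / lam) + B / (2 * lam) * (β - α)) + M * (Real.pi / lam)
      + B / (2 * lam) * (β - α) := by field_simp; ring
  have : 0 ≤ B / (2 * lam) * (β - α) := mul_nonneg (by positivity) (by linarith)
  linarith

lemma aux_first (α β : ℝ) (hαβ : α ≤ β) (φ p q : ℝ → ℝ) (a a' : ℝ → ℂ) (M B Q lam : ℝ)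
    (hlam : 0 < lam)
    (hφ : ∀ z ∈ Set.Icc α β, HasDerivAt φ (p z) z)
    (hp : ∀ z ∈ Set.Icc α β, HasDerivAt p (q z) z) (hq : ContinuousOn q (Set.Icc α β))
    (ha : ∀ z ∈ Set.Icc α β, HasDerivAt a (a' z) z) (ha' : ContinuousOn a' (Set.Icc α β))
    (hpm : ∀ z ∈ Set.Icc α β, lam ≤ |p z|)
    (haq : ∀ z ∈ Set.Icc α β, ‖a z‖ * |q z| ≤ Q)
    (haM : ∀ z ∈ Set.Icc α β, ‖a z‖ ≤ M) (haB : ∀ z ∈ Set.Icc α β, ‖a' z‖ ≤ B) :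
    ‖∫ z in α..β, Complex.exp (Complex.I * (φ z : ℂ)) * a z‖
      ≤ 2 * M / lam + (B / lam + Q / lam ^ 2) * (β - α) := by
  have hpc : ContinuousOn p (Set.Icc α β) := fun z hz => (hp z hz).continuousAt.continuousWithinAt
  have hac : ContinuousOn a (Set.Icc α β) := fun z hz => (ha z hz).continuousAt.continuousWithinAt
  have hp0 : ∀ z ∈ Set.Icc α β, p z ≠ 0 := by
    intro z hz h
    have := hpm z hz
    rw [h, abs_zero] at this; linarith
  let g : ℝ → ℂ := fun z => (((p z)⁻¹ : ℝ) : ℂ) * a z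
  let g' : ℝ → ℂ := fun z => ((-q z / p z ^ 2 : ℝ) : ℂ) * a z + (((p z)⁻¹ : ℝ) : ℂ) * a' z
  have hg : ∀ z ∈ Set.Icc α β, HasDerivAt g (g' z) z := fun z hz =>
    ((hp z hz).fun_inv (hp0 z hz)).ofReal_comp.mul (ha z hz)
  have hg'c : ContinuousOn g' (Set.Icc α β) := by
    have h1 : ContinuousOn (fun z => -q z / p z ^ 2) (Set.Icc α β) :=
      hq.neg.div (hpc.pow 2) (fun z hz => pow_ne_zero 2 (hp0 z hz))
    have h2 : ContinuousOn (fun z => (p z)⁻¹) (Set.Icc α β) := hpc.inv₀ hp0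
    exact ((Complex.continuous_ofReal.comp_continuousOn h1).mul hac).add
      ((Complex.continuous_ofReal.comp_continuousOn h2).mul ha')
  have h1 := aux_ibp α β hαβ φ p g g' hφ hpc hg hg'c
  have hinv : ∀ z ∈ Set.Icc α β, |(p z)⁻¹| ≤ lam⁻¹ := by
    intro z hz
    rw [abs_inv]; exact inv_anti₀ hlam (hpm z hz)
  have hgb : ∀ z ∈ Set.Icc α β, ‖g z‖ ≤ M / lam := by
    intro z hz
    simp only [g, norm_mul, Complex.norm_real, Real.norm_eq_abs]
    calc _ ≤ lam⁻¹ * M := mul_le_mul (hinv z hz) (haM z hz) (norm_nonneg _) (by positivity)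
      _ = _ := by ring
  have hg'b : ∀ z ∈ Set.Icc α β, ‖g' z‖ ≤ B / lam + Q / lam ^ 2 := by
    intro z hz
    rw [add_comm (B / lam)]
    refine (norm_add_le _ _).trans (add_le_add ?_ ?_)
    · simp only [norm_mul, Complex.norm_real, Real.norm_eq_abs]
      rw [abs_div, abs_neg, abs_pow]
      have hpp := hpm z hz
      have hpp0 : 0 < |p z| := lt_of_lt_of_le hlam hpp
      calc _ = (‖a z‖ * |q z|) / |p z| ^ 2 := by ring
        _ ≤ Q / lam ^ 2 := by
          have := haq z hz
          have hQ : 0 ≤ Q := le_trans (by positivity) this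
          gcongr
    · simp only [norm_mul, Complex.norm_real, Real.norm_eq_abs]
      calc _ ≤ lam⁻¹ * B := mul_le_mul (hinv z hz) (haB z hz) (norm_nonneg _) (by positivity)
        _ = _ := by ring
  have h2 : (∫ z in α..β, ‖g' z‖) ≤ (B / lam + Q / lam ^ 2) * (β - α) := by
    calc _ ≤ ∫ z in α..β, (B / lam + Q / lam ^ 2) := by
          refine intervalIntegral.integral_mono_on hαβ ?_ (by simp) hg'b
          apply ContinuousOn.intervalIntegrable; rw [Set.uIcc_of_le hαβ]; exact hg'c.norm
      _ = _ := by simp; ring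
  have e : (∫ z in α..β, Complex.exp (Complex.I * (φ z : ℂ)) * a z)
      = (∫ z in α..β, Complex.exp (Complex.I * (φ z : ℂ)) * ((p z : ℂ) * g z)) := by
    apply intervalIntegral.integral_congr
    intro z hz; rw [Set.uIcc_of_le hαβ] at hz
    have : (p z : ℂ) ≠ 0 := by exact_mod_cast hp0 z hz
    simp only [g]; push_cast
    field_simp
  rw [e]
  have hα := hgb α ⟨le_rfl, hαβ⟩
  have hβ := hgb β ⟨hαβ, le_rfl⟩
  have : 2 * M / lam = M / lam + M / lam := by ring
  linarith

set_option maxHeartbeats 2000000 in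
lemma aux_main (m : ℝ) (hm : 0 < m) :
    ∃ C : ℝ, 0 < C ∧ ∀ (N : ℝ), 2 ≤ N → ∀ (s : ℝ), (s = 1 ∨ s = -1) →
      ∀ (r : ℝ), 0 ≤ r → ∀ (t : ℝ), t ≠ 0 →
      ∀ a : ℝ → ℂ, ContDiffOn ℝ 1 a (Set.Ioi 0) →
        (∀ z : ℝ, 0 < z → ‖a z‖ ≤ z / Real.sqrt (1 + z * r)) →
        (∀ z : ℝ, 0 < z → ‖deriv a z‖ ≤ 1 / Real.sqrt (1 + z * r)) →
        ‖∫ z in (N / 2)..(2 * N),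
            Complex.exp (Complex.I *
              ((-(t * Real.sqrt (z ^ 2 + m ^ 2)) + s * (z * r) : ℝ) : ℂ)) * a z‖
          ≤ C * min (N ^ 2) (min (N * √N / √|t|) (N ^ 2 / |t|)) := by
  obtain ⟨κ, hκ⟩ : ∃ κ, κ = 1 / √(1 + m ^ 2) := ⟨_, rfl⟩
  obtain ⟨W, hW⟩ : ∃ W, W = √(4 + m ^ 2) := ⟨_, rfl⟩
  have hκ0 : 0 < κ := by rw [hκ]; positivity
  have hW0 : 0 < W := by rw [hW]; positivity
  obtain ⟨K1, hK1⟩ : ∃ K1, K1 = 8 / κ + (2 / κ + 4 * m ^ 2 / κ ^ 2) * 2 := ⟨_, rfl⟩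
  obtain ⟨D, hD⟩ : ∃ D, D = √(4 / κ) := ⟨_, rfl⟩
  have hD0 : 0 < D := by rw [hD]; positivity
  have hK1p : 0 < K1 := by rw [hK1]; positivity
  obtain ⟨K3, hK3⟩ : ∃ K3, K3 = (4 + 2 * Real.pi) * D * (√(W ^ 3) / m) := ⟨_, rfl⟩
  have hK3p : 0 < K3 := by rw [hK3]; positivity
  refine ⟨3 + K1 + 2 * D + K3, by positivity, ?_⟩
  intro N hN s hs r hr t ht a ha hab ha'b
  have hN0 : 0 < N := by linarith
  have hT : 0 < |t| := abs_pos.mpr ht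
  have hαβ : N / 2 ≤ 2 * N := by linarith
  have hz1 : ∀ z ∈ Set.Icc (N / 2) (2 * N), 1 ≤ z := fun z hz => by linarith [hz.1]
  have hz0 : ∀ z ∈ Set.Icc (N / 2) (2 * N), 0 < z := fun z hz => by linarith [hz.1]
  have hn : ∀ x : ℝ, ‖Complex.exp (Complex.I * (x : ℂ))‖ = 1 := by
    intro x; rw [mul_comm]; exact Complex.norm_exp_ofReal_mul_I x
  obtain ⟨φ, hφd⟩ : ∃ φ : ℝ → ℝ, φ = fun z => -(t * √(z ^ 2 + m ^ 2)) + s * (z * r) := ⟨_, rfl⟩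
  obtain ⟨p, hpd⟩ : ∃ p : ℝ → ℝ, p = fun z => -(t * (z / √(z ^ 2 + m ^ 2))) + s * r := ⟨_, rfl⟩
  obtain ⟨q, hqd⟩ : ∃ q : ℝ → ℝ, q = fun z => -(t * (m ^ 2 / √(z ^ 2 + m ^ 2) ^ 3)) := ⟨_, rfl⟩
  have hω0 : ∀ z : ℝ, 0 < √(z ^ 2 + m ^ 2) := fun z => by positivity
  have hωs : ∀ z : ℝ, √(z ^ 2 + m ^ 2) ^ 2 = z ^ 2 + m ^ 2 := fun z => Real.sq_sqrt (by positivity)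
  have hωd : ∀ z : ℝ, HasDerivAt (fun z => √(z ^ 2 + m ^ 2)) (z / √(z ^ 2 + m ^ 2)) z := by
    intro z
    have h := (((hasDerivAt_id z).fun_pow 2).add_const (m ^ 2)).sqrt
      (show (id z) ^ 2 + m ^ 2 ≠ 0 by simp only [id]; positivity)
    refine HasDerivAt.congr_deriv h ?_
    have := hω0 z
    simp only [id]
    field_simp
    norm_num
    try ring
  have hφ : ∀ z ∈ Set.Icc (N / 2) (2 * N), HasDerivAt φ (p z) z := by
    intro z _
    rw [hφd, hpd]
    have h := ((hωd z).const_mul t).fun_neg.fun_add (((hasDerivAt_id z).mul_const r).const_mul s)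
    refine HasDerivAt.congr_deriv h ?_
    simp
  have hp : ∀ z ∈ Set.Icc (N / 2) (2 * N), HasDerivAt p (q z) z := by
    intro z _
    rw [hqd, hpd]
    have h := ((((hasDerivAt_id z).fun_div (hωd z) (hω0 z).ne').const_mul t).fun_neg).add_const (s * r)
    refine HasDerivAt.congr_deriv h ?_
    have h1 := hω0 z
    have h2 := hωs z
    simp only [id]
    field_simp
    rw [h2]; ring
  have hq : ContinuousOn q (Set.Icc (N / 2) (2 * N)) := by
    rw [hqd]
    apply Continuous.continuousOn
    have : ∀ z : ℝ, √(z ^ 2 + m ^ 2) ^ 3 ≠ 0 := fun z => (pow_pos (hω0 z) 3).ne'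
    fun_prop (disch := assumption)
  have had : ∀ z ∈ Set.Icc (N / 2) (2 * N), HasDerivAt a (deriv a z) z := fun z hz =>
    ((ha.differentiableOn (by norm_num)).differentiableAt (Ioi_mem_nhds (hz0 z hz))).hasDerivAt
  have ha'c : ContinuousOn (deriv a) (Set.Icc (N / 2) (2 * N)) :=
    (ha.continuousOn_deriv_of_isOpen isOpen_Ioi (by norm_num)).mono (fun z hz => hz0 z hz)
  have hsq1 : ∀ z ∈ Set.Icc (N / 2) (2 * N), 1 ≤ √(1 + z * r) := by
    intro z hz
    rw [Real.one_le_sqrt]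
    nlinarith [mul_nonneg (hz0 z hz).le hr]
  have haz : ∀ z ∈ Set.Icc (N / 2) (2 * N), ‖a z‖ ≤ z := fun z hz =>
    (hab z (hz0 z hz)).trans (div_le_self (hz0 z hz).le (hsq1 z hz))
  have haz' : ∀ z ∈ Set.Icc (N / 2) (2 * N), ‖deriv a z‖ ≤ 1 := fun z hz =>
    (ha'b z (hz0 z hz)).trans (div_le_self zero_le_one (hsq1 z hz))
  have hωz : ∀ z ∈ Set.Icc (N / 2) (2 * N), z ≤ √(z ^ 2 + m ^ 2) := by
    intro z hz; apply Real.le_sqrt_of_sq_le; nlinarith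
  have htriv : ∀ M, (∀ z ∈ Set.Icc (N / 2) (2 * N), ‖a z‖ ≤ M) →
      ‖∫ z in (N / 2)..(2 * N), Complex.exp (Complex.I * (φ z : ℂ)) * a z‖ ≤ M * (3 / 2 * N) := by
    intro M hM
    have := intervalIntegral.norm_integral_le_of_norm_le_const (a := N / 2) (b := 2 * N)
      (f := fun z => Complex.exp (Complex.I * (φ z : ℂ)) * a z) (C := M) (by
        intro z hz
        rw [Set.uIoc_of_le hαβ] at hz
        rw [norm_mul, hn, one_mul]; exact hM z ⟨hz.1.le, hz.2⟩)
    rw [abs_of_nonneg (by linarith)] at this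
    refine this.trans (le_of_eq (by ring))
  have hgoal : (∫ z in (N / 2)..(2 * N),
            Complex.exp (Complex.I *
              ((-(t * Real.sqrt (z ^ 2 + m ^ 2)) + s * (z * r) : ℝ) : ℂ)) * a z)
      = ∫ z in (N / 2)..(2 * N), Complex.exp (Complex.I * (φ z : ℂ)) * a z := by
    rw [hφd]
  rw [hgoal]
  generalize hX : ‖∫ z in (N / 2)..(2 * N), Complex.exp (Complex.I * (φ z : ℂ)) * a z‖ = X
  have hX0 : 0 ≤ X := by rw [← hX]; positivity
  have b1 : X ≤ 3 * N ^ 2 := by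
    rw [← hX]
    refine (htriv (2 * N) (fun z hz => (haz z hz).trans hz.2)).trans (le_of_eq (by ring))
  have hsN : 0 < √N := Real.sqrt_pos.mpr hN0
  have hsT : 0 < √|t| := Real.sqrt_pos.mpr hT
  have hsN2 : √N ^ 2 = N := Real.sq_sqrt hN0.le
  have hsT2 : √|t| ^ 2 = |t| := Real.sq_sqrt hT.le
  have main : X ≤ K1 * (N / |t|) ∨ (X ≤ 2 * D * (N * √N / √|t|) ∧ X ≤ K3 * (N ^ 2 / |t|)) := by
    rcases lt_or_ge r (κ * |t| / 2) with hrt | hrt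
    · left
      have hf := aux_first (N / 2) (2 * N) hαβ φ p q a (deriv a) (2 * N) 1 (|t| * m ^ 2)
        (κ * |t| / 2) (by positivity) hφ hp hq had ha'c
        (by
          intro z hz
          have h1 : κ ≤ z / √(z ^ 2 + m ^ 2) := by
            rw [hκ, div_le_div_iff₀ (by positivity) (hω0 z), one_mul]
            rw [Real.sqrt_le_left (mul_nonneg (hz0 z hz).le (by positivity)), mul_pow,
              Real.sq_sqrt (by positivity)]
            nlinarith [hz1 z hz, mul_nonneg (sq_nonneg m) (show 0 ≤ z ^ 2 - 1 by nlinarith [hz1 z hz])]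
          have h2 : |t * (z / √(z ^ 2 + m ^ 2))| ≥ |t| * κ := by
            rw [abs_mul, abs_of_nonneg (hκ0.le.trans h1)]
            gcongr
          have h3 : |s * r| = r := by
            rcases hs with h | h <;> subst h <;> simp [abs_of_nonneg hr]
          have h4 : |t * (z / √(z ^ 2 + m ^ 2))| - |s * r| ≤ |p z| := by
            rw [hpd]
            have := abs_sub_abs_le_abs_sub (t * (z / √(z ^ 2 + m ^ 2))) (s * r)
            refine this.trans (le_of_eq ?_)
            rw [← abs_neg]; congr 1; ring
          linarith)
        (by
          intro z hz
          rw [hqd]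
          simp only [abs_neg, abs_mul]
          rw [abs_of_pos (a := m ^ 2 / √(z ^ 2 + m ^ 2) ^ 3) (by have := hω0 z; positivity)]
          have h1 : z ≤ √(z ^ 2 + m ^ 2) ^ 3 := by
            have h2 := hωz z hz
            have h3 := hz1 z hz
            have : z ^ 3 ≤ √(z ^ 2 + m ^ 2) ^ 3 := by have := hz0 z hz; gcongr
            refine le_trans ?_ this
            exact le_self_pow₀ h3 (by norm_num)
          have h4 := haz z hz
          have h5 : ‖a z‖ * (|t| * (m ^ 2 / √(z ^ 2 + m ^ 2) ^ 3))
            = (|t| * m ^ 2) * (‖a z‖ / √(z ^ 2 + m ^ 2) ^ 3) := by ring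
          rw [h5]
          apply mul_le_of_le_one_right (by positivity)
          rw [div_le_one (by have := hω0 z; positivity)]
          linarith)
        (fun z hz => (haz z hz).trans hz.2) haz'
      rw [hX] at hf
      refine hf.trans ?_
      have e : K1 * (N / |t|) = 2 * (2 * N) / (κ * |t| / 2) + (1 / (κ * |t| / 2) +
          |t| * m ^ 2 / (κ * |t| / 2) ^ 2) * (2 * N) := by
        rw [hK1]; field_simp; ring
      rw [e]
      gcongr
      linarith
    · right
      have hr0 : 0 < r := lt_of_lt_of_le (by positivity) hrt
      obtain ⟨M, hMd⟩ : ∃ M, M = D * (√N / √|t|) := ⟨_, rfl⟩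
      have hM0 : 0 < M := by rw [hMd]; positivity
      have hM2 : M ^ 2 = 4 * N / (κ * |t|) := by
        rw [hMd, mul_pow, div_pow, hsN2, hsT2, hD, Real.sq_sqrt (by positivity)]
        field_simp
      have hzM : ∀ z ∈ Set.Icc (N / 2) (2 * N), z / √(1 + z * r) ≤ M := by
        intro z hz
        have hzz := hz0 z hz
        rw [div_le_iff₀ (by positivity)]
        refine (pow_le_pow_iff_left₀ hzz.le (by positivity) two_ne_zero).mp ?_
        rw [mul_pow, Real.sq_sqrt (by positivity), hM2, div_mul_eq_mul_div,
          le_div_iff₀ (by positivity)]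
        have h1 : κ * |t| ≤ 2 * r := by linarith
        calc z ^ 2 * (κ * |t|) ≤ z ^ 2 * (2 * r) := by gcongr
          _ = 2 * z * (z * r) := by ring
          _ ≤ 2 * (2 * N) * (1 + z * r) := by
            have := hz.2
            gcongr
            linarith
          _ = _ := by ring
      have haM : ∀ z ∈ Set.Icc (N / 2) (2 * N), ‖a z‖ ≤ M := fun z hz =>
        (hab z (hz0 z hz)).trans (hzM z hz)
      have haB : ∀ z ∈ Set.Icc (N / 2) (2 * N), ‖deriv a z‖ ≤ 2 * M / N := by
        intro z hz
        have hzz := hz0 z hz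
        refine (ha'b z hzz).trans ?_
        have h1 := hzM z hz
        rw [le_div_iff₀ hN0]
        have h2 : 1 / √(1 + z * r) * N ≤ 2 * (z / √(1 + z * r)) := by
          have : 2 * (z / √(1 + z * r)) = 1 / √(1 + z * r) * (2 * z) := by ring
          rw [this]
          gcongr
          linarith [hz.1]
        linarith
      constructor
      · rw [← hX]
        refine (htriv M haM).trans ?_
        have : 2 * D * (N * √N / √|t|) = M * (2 * N) := by rw [hMd]; ring
        rw [this]
        gcongr
        norm_num
      · obtain ⟨lam, hlamd⟩ : ∃ lam, lam = √|t| * m / (√(W ^ 3) * (N * √N)) := ⟨_, rfl⟩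
        have hlam0 : 0 < lam := by rw [hlamd]; positivity
        have hlam2 : lam ^ 2 = |t| * (m ^ 2 / (N * W) ^ 3) := by
          rw [hlamd, div_pow, mul_pow, mul_pow, mul_pow, hsN2, hsT2, Real.sq_sqrt (by positivity)]
          field_simp
        obtain ⟨ε, hε, hεt⟩ : ∃ ε : ℝ, (ε = 1 ∨ ε = -1) ∧ ε * (-t) = |t| := by
          rcases lt_or_gt_of_ne ht with h | h
          · exact ⟨1, Or.inl rfl, by rw [abs_of_neg h]; ring⟩
          · exact ⟨-1, Or.inr rfl, by rw [abs_of_pos h]; ring⟩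
        have hv := aux_vdc (N / 2) (2 * N) hαβ φ p q a (deriv a) M (2 * M / N) lam ε hM0.le hlam0 hε
          hφ hp hq had ha'c
          (by
            intro z hz
            have hzz := hz0 z hz
            have e : ε * q z = |t| * (m ^ 2 / √(z ^ 2 + m ^ 2) ^ 3) := by
              rw [hqd, ← hεt]; ring
            rw [e, hlam2]
            have h1 := hω0 z
            have h2 : √(z ^ 2 + m ^ 2) ≤ N * W := by
              rw [Real.sqrt_le_left (by positivity), mul_pow, hW, Real.sq_sqrt (by positivity)]
              have h3 : z ^ 2 ≤ (2 * N) ^ 2 := by have := hz.2; gcongr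
              nlinarith [mul_nonneg (sq_nonneg m) (show 0 ≤ N ^ 2 - 1 by nlinarith)]
            gcongr)
          haM haB
        rw [hX] at hv
        refine hv.trans (le_of_eq ?_)
        have : (M + 2 * M / N * (2 * N - N / 2) + 2 * Real.pi * M) = (4 + 2 * Real.pi) * M := by
          field_simp; ring
        rw [this, hMd, hlamd, hK3]
        rw [show N ^ 2 / |t| = N * √N ^ 2 / √|t| ^ 2 by rw [hsN2, hsT2]; ring]
        field_simp
  have hNt : 0 < N / |t| := by positivity
  have hNt2 : 0 < N ^ 2 / |t| := by positivity
  have hNs : 0 < N * √N / √|t| := by positivity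
  rw [mul_min_of_nonneg _ _ (by positivity), mul_min_of_nonneg _ _ (by positivity)]
  refine le_min ?_ (le_min ?_ ?_)
  · refine b1.trans ?_
    gcongr
    linarith
  · rcases main with h | ⟨h, _⟩
    · rcases le_total 1 (√N * √|t|) with h1 | h1
      · have h2 : N / |t| ≤ N * √N / √|t| := by
          rw [div_le_div_iff₀ hT hsT]
          nth_rewrite 2 [← hsT2]
          have : 0 ≤ N * √|t| * (√N * √|t| - 1) := mul_nonneg (by positivity) (by linarith)
          nlinarith
        calc X ≤ K1 * (N * √N / √|t|) := h.trans (by gcongr)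
          _ ≤ _ := by gcongr; linarith
      · have h2 : N ^ 2 ≤ N * √N / √|t| := by
          rw [le_div_iff₀ hsT]
          have : 0 ≤ N * √N * (1 - √N * √|t|) := mul_nonneg (by positivity) (by linarith)
          have e : N ^ 2 * √|t| = N * √N ^ 2 * √|t| := by rw [hsN2]; ring
          rw [e]; nlinarith
        calc X ≤ 3 * (N * √N / √|t|) := b1.trans (by gcongr)
          _ ≤ _ := by gcongr; linarith
    · refine h.trans ?_
      gcongr
      linarith
  · rcases main with h | ⟨_, h⟩
    · have h2 : N / |t| ≤ N ^ 2 / |t| := by gcongr; nlinarith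
      calc X ≤ K1 * (N ^ 2 / |t|) := h.trans (by gcongr)
        _ ≤ _ := by gcongr; linarith
    · refine h.trans ?_
      gcongr
      linarith

theorem stmt8 (m c : ℝ) (hm : 0 < m) (hc : 0 < c) :
    ∃ C : ℝ, 0 < C ∧ ∀ (j : ℕ), 1 ≤ j → ∀ (s : ℝ), (s = 1 ∨ s = -1) →
      ∀ (r : ℝ), 0 ≤ r → ∀ (t : ℝ), t ≠ 0 →
      ∀ a : ℝ → ℂ, ContDiffOn ℝ 1 a (Set.Ioi 0) →
        (∀ z : ℝ, 0 < z → (z < (2:ℝ) ^ ((j : ℝ) - 1) ∨ (2:ℝ) ^ ((j : ℝ) + 1) < z) → a z = 0) →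
        (∀ z : ℝ, 0 < z → z * r ≤ c → a z = 0) →
        (∀ z : ℝ, 0 < z → ‖a z‖ ≤ z / Real.sqrt (1 + z * r)) →
        (∀ z : ℝ, 0 < z → ‖deriv a z‖ ≤ 1 / Real.sqrt (1 + z * r)) →
        ‖∫ z in Set.Ioi (0 : ℝ),
            Complex.exp (Complex.I *
              ((-(t * Real.sqrt (z ^ 2 + m ^ 2)) + s * (z * r) : ℝ) : ℂ)) * a z‖
          ≤ C * min ((2:ℝ) ^ (2 * (j : ℝ)))
              (min ((2:ℝ) ^ (3 * (j : ℝ) / 2) / Real.sqrt |t|)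
                ((2:ℝ) ^ (2 * (j : ℝ)) / |t|)) := by
  obtain ⟨C, hC, H⟩ := aux_main m hm
  refine ⟨C, hC, ?_⟩
  intro j hj s hs r hr t ht a ha hsupp _ hab ha'b
  have hN : (2:ℝ) ≤ (2:ℝ) ^ (j:ℝ) := by
    rw [Real.rpow_natCast]
    exact le_self_pow₀ (by norm_num) (by omega)
  have h := H ((2:ℝ) ^ (j:ℝ)) hN s hs r hr t ht a ha hab ha'b
  have e1 : (2:ℝ) ^ ((j : ℝ) - 1) = (2:ℝ) ^ (j:ℝ) / 2 := by
    rw [Real.rpow_sub (by norm_num), Real.rpow_one]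
  have e2 : (2:ℝ) ^ ((j : ℝ) + 1) = 2 * (2:ℝ) ^ (j:ℝ) := by
    rw [Real.rpow_add (by norm_num), Real.rpow_one, mul_comm]
  have e3 : (2:ℝ) ^ (2 * (j : ℝ)) = ((2:ℝ) ^ (j:ℝ)) ^ 2 := by
    rw [mul_comm, Real.rpow_mul (by norm_num)]; norm_num
  have e4 : (2:ℝ) ^ (3 * (j : ℝ) / 2) = (2:ℝ) ^ (j:ℝ) * √((2:ℝ) ^ (j:ℝ)) := by
    rw [Real.sqrt_eq_rpow, ← Real.rpow_mul (by norm_num), ← Real.rpow_add (by norm_num)]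
    congr 1; ring
  rw [e1, e2] at hsupp
  rw [e3, e4]
  generalize (2:ℝ) ^ (j:ℝ) = N at *
  convert h using 2
  rw [intervalIntegral.integral_of_le (by linarith), ← integral_Icc_eq_integral_Ioc]
  apply setIntegral_eq_of_subset_of_forall_sdiff_eq_zero measurableSet_Ioi
  · intro z hz
    have := hz.1
    simp only [Set.mem_Ioi]; linarith
  · intro z hz
    have hz0 : 0 < z := hz.1
    rw [hsupp z hz0, mul_zero]
    by_contra hcon
    push Not at hcon
    exact hz.2 hcon
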